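/- Let ε = (ε_0, …, ε_d) be a bijection from ZMod (d+1) to {0,…,d} with ε_d = d, and suppose both colors ε_0 and ε_{d−1} satisfy the path condition. Let c ∈ {ε_0, ε_{d−1}}. Then the regular genus of the capped regular (d+1)-colored graph Γ̃^{(c)} = (π_0,…,π_{d−1}, π̃^{(c)}) with respect to ε equals the regular genus of the graph with boundary Γ with respect to ε: ρ_ε(Γ̃^{(c)}) = ρ_ε(Γ). -/

import Mathlib

/-- The number of orbits on `V` of the subgroup of the symmetric group on `V`
generated by a set `S` of permutations. -/
noncomputable def numOrbits {V : Type*} [Fintype V] (S : Set (Equiv.Perm V)) : ℕ :=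
  Nat.card (MulAction.orbitRel.Quotient (Subgroup.closure S) V)

/-- The number of orbits on `V` of the subgroup generated by `S` that are disjoint
from a given set `F`. -/
noncomputable def numOrbitsAway {V : Type*} [Fintype V] (S : Set (Equiv.Perm V))
    (F : Set V) : ℕ :=
  Nat.card {ω : MulAction.orbitRel.Quotient (Subgroup.closure S) V // ω.orbit ∩ F = ∅}

theorem aux_orbit_sub {V : Type*} (S : Set (Equiv.Perm V))
    (hS : ∀ s ∈ S, s * s = 1) (A : Set V) (hA : ∀ s ∈ S, ∀ z ∈ A, s z ∈ A)
    {x : V} (hx : x ∈ A) : MulAction.orbit (Subgroup.closure S) x ⊆ A := by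
  rintro _ ⟨⟨g, hg⟩, rfl⟩
  have key : ∀ z, z ∈ A ↔ g z ∈ A := by
    clear hx
    induction hg using Subgroup.closure_induction with
    | mem s hs =>
      intro z
      refine ⟨hA s hs z, fun h => ?_⟩
      have h1 := hA s hs _ h
      have h2 : s (s z) = z := by
        rw [← Equiv.Perm.mul_apply, hS s hs]; rfl
      rwa [h2] at h1
    | one => intro z; rfl
    | mul g h _ _ ihg ihh =>
      intro z
      rw [ihh, ihg]; rfl
    | inv g _ ih =>
      intro z
      rw [ih (g⁻¹ z)]
      simp
  exact (key x).1 hx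

theorem aux_self {V : Type*} (S : Set (Equiv.Perm V)) (x : V) :
    x ∈ MulAction.orbit (Subgroup.closure S) x := MulAction.mem_orbit_self x

theorem aux_symm {V : Type*} {S : Set (Equiv.Perm V)} {x y : V}
    (h : x ∈ MulAction.orbit (Subgroup.closure S) y) :
    y ∈ MulAction.orbit (Subgroup.closure S) x := MulAction.mem_orbit_symm.1 h

theorem aux_trans {V : Type*} {S : Set (Equiv.Perm V)} {x y z : V}
    (h : x ∈ MulAction.orbit (Subgroup.closure S) y)
    (h' : y ∈ MulAction.orbit (Subgroup.closure S) z) :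
    x ∈ MulAction.orbit (Subgroup.closure S) z := by
  rwa [← MulAction.orbit_eq_iff.2 h']

theorem aux_gen {V : Type*} {S : Set (Equiv.Perm V)} {s : Equiv.Perm V} (hs : s ∈ S)
    (x : V) : s x ∈ MulAction.orbit (Subgroup.closure S) x :=
  ⟨⟨s, Subgroup.subset_closure hs⟩, rfl⟩

theorem aux_gen' {V : Type*} {S : Set (Equiv.Perm V)} {s : Equiv.Perm V} (hs : s ∈ S)
    {x y : V} (h : x ∈ MulAction.orbit (Subgroup.closure S) y) :
    s x ∈ MulAction.orbit (Subgroup.closure S) y :=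
  aux_trans (aux_gen hs x) h

/-- set of orbits -/
def auxOrb {V : Type*} (S : Set (Equiv.Perm V)) : Set (Set V) :=
  Set.range fun x : V => MulAction.orbit (Subgroup.closure S) x

theorem aux_orbit_mk {V : Type*} (S : Set (Equiv.Perm V)) (x : V) :
    MulAction.orbitRel.Quotient.orbit
      (Quotient.mk'' x : MulAction.orbitRel.Quotient (Subgroup.closure S) V)
      = MulAction.orbit (Subgroup.closure S) x :=
  MulAction.orbitRel.Quotient.orbit_mk x

theorem aux_numOrbits {V : Type*} [Fintype V] (S : Set (Equiv.Perm V)) :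
    numOrbits S = (auxOrb S).ncard := by
  unfold numOrbits
  rw [← Nat.card_coe_set_eq]
  refine Nat.card_congr (Equiv.ofBijective (fun ω => ⟨ω.orbit, ?_⟩) ⟨?_, ?_⟩)
  · induction ω using Quotient.inductionOn' with
    | h x => exact ⟨x, (aux_orbit_mk S x).symm⟩
  · intro a b h
    exact MulAction.orbitRel.Quotient.orbit_injective (by simpa using h)
  · rintro ⟨_, x, rfl⟩
    exact ⟨Quotient.mk'' x, Subtype.ext (aux_orbit_mk S x)⟩

theorem aux_numOrbitsAway {V : Type*} [Fintype V] (S : Set (Equiv.Perm V)) (F : Set V) :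
    numOrbitsAway S F = {O ∈ auxOrb S | O ∩ F = ∅}.ncard := by
  unfold numOrbitsAway
  rw [← Nat.card_coe_set_eq]
  refine Nat.card_congr (Equiv.ofBijective (fun ω => ⟨ω.1.orbit, ?_, ω.2⟩) ⟨?_, ?_⟩)
  · obtain ⟨ω, hω⟩ := ω
    induction ω using Quotient.inductionOn' with
    | h x => exact ⟨x, (aux_orbit_mk S x).symm⟩
  · intro a b h
    exact Subtype.ext (MulAction.orbitRel.Quotient.orbit_injective (by simpa using h))
  · rintro ⟨_, ⟨x, rfl⟩, hx⟩
    exact ⟨⟨Quotient.mk'' x, by rw [aux_orbit_mk]; exact hx⟩, Subtype.ext (aux_orbit_mk S x)⟩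

theorem aux_split {V : Type*} [Fintype V] (S : Set (Equiv.Perm V)) (F : Set V) :
    numOrbits S = numOrbitsAway S F + {O ∈ auxOrb S | (O ∩ F).Nonempty}.ncard := by
  rw [aux_numOrbits, aux_numOrbitsAway, ← Set.ncard_union_eq]
  · congr 1
    ext O
    simp only [Set.mem_union, Set.mem_setOf_eq, ← and_or_left]
    have := Set.eq_empty_or_nonempty (O ∩ F)
    tauto
  · rw [Set.disjoint_left]
    rintro O ⟨_, h⟩ ⟨_, h'⟩
    exact h'.ne_empty h

theorem aux_away_sub {V : Type*} (a e t : Equiv.Perm V) (F : Set V)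
    (ha : a * a = 1) (ht : t * t = 1) (hte : ∀ x, x ∉ F → t x = e x) (x : V)
    (hx : MulAction.orbit (Subgroup.closure {a, e}) x ∩ F = ∅) :
    MulAction.orbit (Subgroup.closure {a, t}) x ⊆
      MulAction.orbit (Subgroup.closure {a, e}) x := by
  apply aux_orbit_sub
  · rintro s (rfl | rfl) <;> assumption
  · rintro s (rfl | rfl) z hz
    · exact aux_gen' (by simp) hz
    · have : z ∉ F := fun h => by
        have : z ∈ (∅ : Set V) := hx ▸ ⟨hz, h⟩
        exact this
      rw [hte z this]
      exact aux_gen' (by simp) hz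
  · exact aux_self _ _

theorem aux_away_eq {V : Type*} (a e t : Equiv.Perm V) (F : Set V)
    (ha : a * a = 1) (he : e * e = 1) (ht : t * t = 1) (hte : ∀ x, x ∉ F → t x = e x) (x : V)
    (hx : MulAction.orbit (Subgroup.closure {a, e}) x ∩ F = ∅) :
    MulAction.orbit (Subgroup.closure {a, t}) x =
      MulAction.orbit (Subgroup.closure {a, e}) x := by
  have h1 := aux_away_sub a e t F ha ht hte x hx
  refine h1.antisymm (aux_away_sub a t e F ha he (fun y hy => (hte y hy).symm) x ?_)
  exact Set.subset_eq_empty (Set.inter_subset_inter_left _ h1) hx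

theorem aux_away {V : Type*} [Fintype V] (a e t : Equiv.Perm V) (F : Set V)
    (ha : a * a = 1) (he : e * e = 1) (ht : t * t = 1) (hte : ∀ x, x ∉ F → t x = e x) :
    numOrbitsAway {a, t} F = numOrbitsAway {a, e} F := by
  rw [aux_numOrbitsAway, aux_numOrbitsAway]
  congr 1
  ext O
  constructor
  · rintro ⟨⟨x, rfl⟩, hx⟩
    exact ⟨⟨x, aux_away_eq a t e F ha ht he (fun y hy => (hte y hy).symm) x hx⟩, hx⟩
  · rintro ⟨⟨x, rfl⟩, hx⟩
    exact ⟨⟨x, aux_away_eq a e t F ha he ht hte x hx⟩, hx⟩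

/-- orbits of `⟨a,e⟩` are contained in those of `⟨a,t⟩`. -/
theorem aux_le {V : Type*} (a e t : Equiv.Perm V)
    (ha : a * a = 1) (he : e * e = 1)
    (hte : ∀ x, e x ≠ x → t x = e x) (x : V) :
    MulAction.orbit (Subgroup.closure {a, e}) x ⊆
      MulAction.orbit (Subgroup.closure {a, t}) x := by
  apply aux_orbit_sub
  · rintro s (rfl | rfl) <;> assumption
  · rintro s (rfl | rfl) z hz
    · exact aux_gen' (by simp) hz
    · by_cases h : s z = z
      · rwa [h]
      · rw [← hte z h]
        exact aux_gen' (by simp) hz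
  · exact aux_self _ _

theorem aux_first {V : Type*} [Fintype V] (a e t : Equiv.Perm V) (pbar : ℕ)
    (hpbar : Nat.card {y : V | e y = y} = 2 * pbar)
    (ha : a * a = 1) (he : e * e = 1) (ht : t * t = 1)
    (hpath : ∀ x : V,
      (MulAction.orbit (Subgroup.closure {a, e}) x ∩ {y : V | e y = y}).ncard = 0 ∨
      (MulAction.orbit (Subgroup.closure {a, e}) x ∩ {y : V | e y = y}).ncard = 2)
    (hte : ∀ x, e x ≠ x → t x = e x)
    (hfix : ∀ x, e x = x → e (t x) = t x ∧ t x ≠ x ∧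
      t x ∈ MulAction.orbit (Subgroup.closure {a, e}) x) :
    numOrbits {a, t} = numOrbitsAway {a, e} {y : V | e y = y} + pbar := by
  classical
  rw [aux_split _ {y : V | e y = y}, aux_away a e t {y : V | e y = y} ha he ht (fun x hx => hte x hx)]
  congr 1
  have horb : ∀ x : V, MulAction.orbit (Subgroup.closure {a, t}) x =
      MulAction.orbit (Subgroup.closure {a, e}) x := by
    intro x
    refine Set.Subset.antisymm ?_ (aux_le a e t ha he hte x)
    apply aux_orbit_sub
    · rintro s (rfl | rfl) <;> assumption
    · rintro s (rfl | rfl) z hz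
      · exact aux_gen' (by simp) hz
      · by_cases h : e z = z
        · exact aux_trans (hfix z h).2.2 hz
        · rw [hte z h]
          exact aux_gen' (by simp) hz
    · exact aux_self _ _
  set F : Set V := {y : V | e y = y} with hF
  set M : Set (Set V) := {O ∈ auxOrb {a, t} | (O ∩ F).Nonempty} with hM
  have hcard := Finset.card_eq_sum_card_fiberwise (s := F.toFinset) (t := M.toFinset)
    (f := fun x => MulAction.orbit (Subgroup.closure {a, t}) x) (by
      intro x hx
      have hx' : x ∈ F := by simpa using hx
      simp only [Set.coe_toFinset]
      exact ⟨⟨x, rfl⟩, ⟨x, aux_self _ _, hx'⟩⟩)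
  have h2 : ∀ O ∈ M.toFinset, (F.toFinset.filter
      (fun x => MulAction.orbit (Subgroup.closure {a, t}) x = O)).card = 2 := by
    intro O hO
    rw [Set.mem_toFinset] at hO
    obtain ⟨⟨x, rfl⟩, hne⟩ := hO
    rw [← Set.ncard_coe_finset]
    have : (↑(F.toFinset.filter (fun y => MulAction.orbit (Subgroup.closure {a, t}) y =
        (fun x => MulAction.orbit (Subgroup.closure {a, t}) x) x)) : Set V)
        = MulAction.orbit (Subgroup.closure {a, e}) x ∩ F := by
      ext y
      simp only [Finset.coe_filter, Set.mem_toFinset, Set.mem_setOf_eq, Set.mem_inter_iff,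
        MulAction.orbit_eq_iff, horb]
      tauto
    rw [this]
    refine (hpath x).resolve_left ?_
    simp only [horb] at hne
    exact fun h => hne.ne_empty ((Set.ncard_eq_zero).1 h)
  rw [Finset.sum_congr rfl h2, Finset.sum_const, smul_eq_mul, ← Set.ncard_eq_toFinset_card',
    ← Set.ncard_eq_toFinset_card', ← Nat.card_coe_set_eq, hpbar] at hcard
  omega

theorem aux_second {V : Type*} [Fintype V] [DecidableEq V] (a a' e t t' : Equiv.Perm V)
    (b b' : Equiv.Perm {y : V // e y = y})
    (ha : a * a = 1) (ha' : a' * a' = 1) (he : e * e = 1) (ht : t * t = 1) (ht' : t' * t' = 1)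
    (hpath' : ∀ x : V,
      (MulAction.orbit (Subgroup.closure {a', e}) x ∩ {y : V | e y = y}).ncard = 0 ∨
      (MulAction.orbit (Subgroup.closure {a', e}) x ∩ {y : V | e y = y}).ncard = 2)
    (hte : ∀ x, e x ≠ x → t x = e x)
    (hfix' : ∀ x, e x = x → e (t' x) = t' x ∧ t' x ≠ x ∧
      t' x ∈ MulAction.orbit (Subgroup.closure {a', e}) x)
    (hb : ∀ y : {y : V // e y = y}, (b y : V) = t y)
    (hb' : ∀ y : {y : V // e y = y}, (b' y : V) = t' y) :
    numOrbits {a', t} = numOrbitsAway {a', e} {y : V | e y = y} + numOrbits {b, b'} := by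
  classical
  rw [aux_split _ {y : V | e y = y}, aux_away a' e t {y : V | e y = y} ha' he ht (fun x hx => hte x hx)]
  congr 1
  have hbb : b * b = 1 := by
    ext y
    rw [Equiv.Perm.mul_apply, hb, hb, ← Equiv.Perm.mul_apply, ht]; rfl
  have hbb' : b' * b' = 1 := by
    ext y
    rw [Equiv.Perm.mul_apply, hb', hb', ← Equiv.Perm.mul_apply, ht']; rfl
  have hinvb : ∀ s ∈ ({b, b'} : Set (Equiv.Perm {y : V // e y = y})), s * s = 1 := by
    rintro s (rfl | rfl) <;> assumption
  -- the fixed points in an orbit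
  have htwo : ∀ x w : V, e x = x → e w = w →
      w ∈ MulAction.orbit (Subgroup.closure {a', e}) x → w = x ∨ w = t' x := by
    intro x w hx hw hwx
    by_contra hcon
    push Not at hcon
    have hsub : ({x, t' x, w} : Set V) ⊆
        MulAction.orbit (Subgroup.closure {a', e}) x ∩ {y : V | e y = y} := by
      rintro z (rfl | rfl | rfl)
      · exact ⟨aux_self _ _, hx⟩
      · exact ⟨(hfix' x hx).2.2, (hfix' x hx).1⟩
      · exact ⟨hwx, hw⟩
    have h3 : ({x, t' x, w} : Set V).ncard = 3 :=
      Set.ncard_eq_three.2 ⟨_, _, _, (hfix' x hx).2.1.symm, hcon.1.symm, hcon.2.symm, rfl⟩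
    have := Set.ncard_le_ncard hsub
    rcases hpath' x with h | h <;> omega
  -- key equivalence
  have hfwd : ∀ x y : {y : V // e y = y},
      (y : V) ∈ MulAction.orbit (Subgroup.closure {a', t}) (x : V) →
      y ∈ MulAction.orbit (Subgroup.closure {b, b'}) x := by
    intro x y hxy
    let A : Set V := {z | ∃ w : {y : V // e y = y},
      (w : V) ∈ MulAction.orbit (Subgroup.closure {a', e}) z ∧
      w ∈ MulAction.orbit (Subgroup.closure {b, b'}) x}
    have hAfix : ∀ z : {y : V // e y = y}, (z : V) ∈ A →
        z ∈ MulAction.orbit (Subgroup.closure {b, b'}) x := by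
      rintro z ⟨w, hw, hwx⟩
      rcases htwo z w z.2 w.2 hw with h | h
      · rwa [← Subtype.ext h]
      · have : w = b' z := Subtype.ext (by rw [h, hb'])
        rw [this] at hwx
        exact aux_trans (aux_symm (aux_gen (s := b') (by simp) z)) hwx
    have hAcl : ∀ s ∈ ({a', e} : Set (Equiv.Perm V)), ∀ z ∈ A, s z ∈ A := by
      rintro s hs z ⟨w, hw, hwx⟩
      exact ⟨w, aux_trans hw (aux_symm (aux_gen hs z)), hwx⟩
    apply hAfix y
    refine aux_orbit_sub {a', t} ?_ A ?_ ?_ hxy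
    · rintro s (rfl | rfl) <;> assumption
    · rintro s (rfl | rfl) z hz
      · exact hAcl s (by simp) z hz
      · by_cases h : e z = z
        · have h1 := hAfix ⟨z, h⟩ hz
          refine ⟨b ⟨z, h⟩, ?_, aux_gen' (by simp) h1⟩
          rw [hb]
          exact aux_self _ _
        · rw [hte z h]
          exact hAcl e (by simp) z hz
    · exact ⟨x, aux_self _ _, aux_self _ _⟩
  have hbwd : ∀ x y : {y : V // e y = y},
      y ∈ MulAction.orbit (Subgroup.closure {b, b'}) x →
      (y : V) ∈ MulAction.orbit (Subgroup.closure {a', t}) (x : V) := by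
    intro x y hxy
    refine aux_orbit_sub {b, b'} hinvb
      {z | (z : V) ∈ MulAction.orbit (Subgroup.closure {a', t}) (x : V)} ?_ (aux_self _ _) hxy
    rintro s (rfl | rfl) z hz
    · simp only [Set.mem_setOf_eq, hb]
      exact aux_gen' (by simp) hz
    · simp only [Set.mem_setOf_eq, hb']
      exact aux_trans (aux_le a' e t ha' he hte z (hfix' z z.2).2.2) hz
  rw [aux_numOrbits]
  symm
  refine Set.ncard_congr (fun O _ => {z : V | ∃ x ∈ O,
    z ∈ MulAction.orbit (Subgroup.closure {a', t}) (x : V)}) ?_ ?_ ?_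
  · rintro _ ⟨x, rfl⟩
    refine ⟨⟨x, ?_⟩, ⟨x, ⟨x, aux_self _ _, aux_self _ _⟩, x.2⟩⟩
    ext z
    constructor
    · intro hz
      exact ⟨x, aux_self _ _, hz⟩
    · rintro ⟨y, hy, hz⟩
      exact aux_trans hz (hbwd x y hy)
  · rintro _ _ ⟨x, rfl⟩ ⟨y, rfl⟩ h
    have : (x : V) ∈ {z : V | ∃ x ∈ MulAction.orbit (Subgroup.closure {b, b'}) y,
        z ∈ MulAction.orbit (Subgroup.closure {a', t}) (x : V)} := by
      rw [← h]
      exact ⟨x, aux_self _ _, aux_self _ _⟩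
    obtain ⟨w, hw, hxw⟩ := this
    exact MulAction.orbit_eq_iff.2 (aux_trans (hfwd w x hxw) hw)
  · rintro _ ⟨⟨x, rfl⟩, ⟨y, hyx, hy⟩⟩
    refine ⟨MulAction.orbit (Subgroup.closure {b, b'}) ⟨y, hy⟩, ⟨_, rfl⟩, ?_⟩
    have hxy : MulAction.orbit (Subgroup.closure {a', t}) x =
        MulAction.orbit (Subgroup.closure {a', t}) y := (MulAction.orbit_eq_iff.2 hyx).symm
    ext z
    simp only [hxy]
    constructor
    · rintro ⟨w, hw, hz⟩
      exact aux_trans hz (hbwd ⟨y, hy⟩ w hw)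
    · intro hz
      exact ⟨⟨y, hy⟩, aux_self _ _, hz⟩

/-- Let `Γ = (π 0, …, π d)` be a `(d+1)`-colored graph with boundary on `V`
(`d ≥ 2`), with `2p̄ = |Fix(π d)|`, `2ṗ = |V| − 2p̄`, `p = ṗ + p̄`.  Let
`ε = (ε_0,…,ε_d)` be a bijection `ZMod (d+1) ≃ Fin (d+1)` with `ε_d = d`, such that
the colors `ε_0` and `ε_{d−1}` satisfy the path condition, and let
`c ∈ {ε_0, ε_{d−1}}` with `c`-capped involution `tc`.  Then the regular genus of the
capped regular graph `Γ̃^{(c)} = (π 0, …, π (d−1), tc)` with respect to `ε` equals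
the regular genus of `Γ` with respect to `ε`:  `ρ_ε(Γ̃^{(c)}) = ρ_ε(Γ)`. -/
theorem capped_regularGenus_eq_of_mem_ends
    {V : Type*} [Fintype V] [DecidableEq V] (d : ℕ) (hd : 2 ≤ d)
    (π : Fin (d + 1) → Equiv.Perm V)
    (hinv : ∀ j, π j * π j = 1)
    (hfpf : ∀ j : Fin (d + 1), j ≠ Fin.last d → ∀ x, π j x ≠ x)
    (pbar pdot p : ℕ)
    (hpbar : Nat.card {y : V | π (Fin.last d) y = y} = 2 * pbar)
    (hpdot : Fintype.card V = 2 * pdot + 2 * pbar)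
    (hp : p = pdot + pbar)
    (ε : ZMod (d + 1) ≃ Fin (d + 1))
    (hεd : ε (d : ZMod (d + 1)) = Fin.last d)
    -- the colors `ε_0` and `ε_{d−1}` satisfy the path condition
    (hpath0 : ∀ x : V,
      (MulAction.orbit (Subgroup.closure {π (ε 0), π (Fin.last d)}) x
          ∩ {y : V | π (Fin.last d) y = y}).ncard = 0 ∨
      (MulAction.orbit (Subgroup.closure {π (ε 0), π (Fin.last d)}) x
          ∩ {y : V | π (Fin.last d) y = y}).ncard = 2)
    (hpath1 : ∀ x : V,
      (MulAction.orbit (Subgroup.closure {π (ε ((d : ZMod (d + 1)) - 1)),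
            π (Fin.last d)}) x
          ∩ {y : V | π (Fin.last d) y = y}).ncard = 0 ∨
      (MulAction.orbit (Subgroup.closure {π (ε ((d : ZMod (d + 1)) - 1)),
            π (Fin.last d)}) x
          ∩ {y : V | π (Fin.last d) y = y}).ncard = 2)
    -- `t0`, `t1` : the capped involutions for the colors `ε_0` and `ε_{d−1}`
    (t0 t1 : Equiv.Perm V)
    (ht0_inv : t0 * t0 = 1) (ht0_fpf : ∀ x, t0 x ≠ x)
    (ht0_out : ∀ x : V, π (Fin.last d) x ≠ x → t0 x = π (Fin.last d) x)
    (ht0_fix : ∀ x : V, π (Fin.last d) x = x →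
      π (Fin.last d) (t0 x) = t0 x ∧ t0 x ≠ x ∧
      t0 x ∈ MulAction.orbit (Subgroup.closure {π (ε 0), π (Fin.last d)}) x)
    (ht1_inv : t1 * t1 = 1) (ht1_fpf : ∀ x, t1 x ≠ x)
    (ht1_out : ∀ x : V, π (Fin.last d) x ≠ x → t1 x = π (Fin.last d) x)
    (ht1_fix : ∀ x : V, π (Fin.last d) x = x →
      π (Fin.last d) (t1 x) = t1 x ∧ t1 x ≠ x ∧
      t1 x ∈ MulAction.orbit (Subgroup.closure {π (ε ((d : ZMod (d + 1)) - 1)),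
        π (Fin.last d)}) x)
    -- the boundary involutions `∂π_{ε_0}` and `∂π_{ε_{d−1}}`
    (b0 b1 : Equiv.Perm {y : V // π (Fin.last d) y = y})
    (hb0 : ∀ y : {y : V // π (Fin.last d) y = y}, (b0 y : V) = t0 y)
    (hb1 : ∀ y : {y : V // π (Fin.last d) y = y}, (b1 y : V) = t1 y)
    -- `c ∈ {ε_0, ε_{d−1}}` and `tc` is its capped involution
    (c : Fin (d + 1)) (tc : Equiv.Perm V)
    (hc : (c = ε 0 ∧ tc = t0) ∨ (c = ε ((d : ZMod (d + 1)) - 1) ∧ tc = t1))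
    -- the capped regular graph `Γ̃^{(c)}`
    (πcap : Fin (d + 1) → Equiv.Perm V)
    (hπcap : ∀ j : Fin (d + 1), πcap j = if j = Fin.last d then tc else π j)
    -- `ġ_{ab}`
    (gdot : Fin (d + 1) → Fin (d + 1) → ℕ)
    (hgdot_last : ∀ a : Fin (d + 1),
      gdot a (Fin.last d)
          = numOrbitsAway {π a, π (Fin.last d)} {y : V | π (Fin.last d) y = y} ∧
      gdot (Fin.last d) a
          = numOrbitsAway {π (Fin.last d), π a} {y : V | π (Fin.last d) y = y})
    (hgdot : ∀ a b : Fin (d + 1), a ≠ Fin.last d → b ≠ Fin.last d →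
      gdot a b = numOrbits {π a, π b})
    -- the regular genus of `Γ` with respect to `ε`
    (ρ : ℚ)
    (hρ : 2 - 2 * ρ = (∑ i : ZMod (d + 1), (gdot (ε i) (ε (i + 1)) : ℚ))
      + (1 - (d : ℚ)) * (pdot : ℚ) + (2 - (d : ℚ)) * (pbar : ℚ)
      + (numOrbits {b0, b1} : ℚ))
    -- the regular genus of `Γ̃^{(c)}` with respect to `ε`
    (ρcap : ℚ)
    (hρcap : 2 - 2 * ρcap
      = (∑ i : ZMod (d + 1), (numOrbits {πcap (ε i), πcap (ε (i + 1))} : ℚ))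
        + (1 - (d : ℚ)) * (p : ℚ)) :
    ρcap = ρ := by
  have hlast : ∀ i : ZMod (d + 1), ε i = Fin.last d ↔ i = (d : ZMod (d + 1)) := by
    intro i
    rw [← hεd]; exact ε.injective.eq_iff
  have hd1 : (d : ZMod (d + 1)) + 1 = 0 := by
    have := ZMod.natCast_self (d + 1)
    push_cast at this
    exact this
  haveI : Fact (1 < d + 1) := ⟨by omega⟩
  have hne : (d : ZMod (d + 1)) - 1 ≠ d := by
    intro h
    have : (1 : ZMod (d + 1)) = 0 := by
      have h' := sub_eq_self.1 h
      exact h'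
    exact one_ne_zero this
  have h0 : (0 : ZMod (d + 1)) ≠ d := by
    intro h
    rw [← h, zero_add] at hd1
    exact one_ne_zero hd1
  have hcaplast : πcap (Fin.last d) = tc := by rw [hπcap, if_pos rfl]
  have hcap : ∀ i : ZMod (d + 1), i ≠ d → πcap (ε i) = π (ε i) := by
    intro i hi
    rw [hπcap, if_neg (fun h => hi ((hlast i).1 h))]
  -- splitting the cyclic sums
  have hsplit : ∀ f : ZMod (d + 1) → ℚ, ∑ i, f i =
      f d + (f (d - 1) + ∑ i ∈ (Finset.univ.erase (d : ZMod (d + 1))).erase (d - 1), f i) := by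
    intro f
    rw [Finset.add_sum_erase _ _ (by simp [hne]), Finset.add_sum_erase _ _ (by simp)]
  have hrest : ∑ i ∈ (Finset.univ.erase (d : ZMod (d + 1))).erase (d - 1),
        (numOrbits {πcap (ε i), πcap (ε (i + 1))} : ℚ) =
      ∑ i ∈ (Finset.univ.erase (d : ZMod (d + 1))).erase (d - 1),
        (gdot (ε i) (ε (i + 1)) : ℚ) := by
    refine Finset.sum_congr rfl fun i hi => ?_
    simp only [Finset.mem_erase, Finset.mem_univ, and_true] at hi
    have hi1 : i + 1 ≠ d := fun h => hi.1 (by rw [← h]; ring)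
    rw [hcap i hi.2, hcap _ hi1, hgdot _ _ (fun h => hi.2 ((hlast i).1 h))
      (fun h => hi1 ((hlast _).1 h))]
  rw [hsplit, hrest] at hρcap
  rw [hsplit] at hρ
  simp only [sub_add_cancel, hd1, hεd, hcaplast, hcap _ hne, hcap _ h0] at hρ hρcap
  rw [(hgdot_last _).1, (hgdot_last _).2] at hρ
  rw [Set.pair_comm (π (Fin.last d))] at hρ
  rw [Set.pair_comm tc] at hρcap
  have hpq : (p : ℚ) = pdot + pbar := by rw [hp]; push_cast; rfl
  rcases hc with ⟨-, rfl⟩ | ⟨-, rfl⟩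
  · have e1 := aux_first (π (ε 0)) (π (Fin.last d)) tc pbar hpbar (hinv _) (hinv _) ht0_inv
      hpath0 ht0_out ht0_fix
    have e2 := aux_second (π (ε 0)) (π (ε ((d : ZMod (d + 1)) - 1))) (π (Fin.last d)) tc t1 b0 b1
      (hinv _) (hinv _) (hinv _) ht0_inv ht1_inv hpath1 ht0_out ht1_fix hb0 hb1
    rw [e1, e2, hpq] at hρcap
    push_cast at hρcap
    linarith
  · have e1 := aux_first (π (ε ((d : ZMod (d + 1)) - 1))) (π (Fin.last d)) tc pbar hpbar
      (hinv _) (hinv _) ht1_inv hpath1 ht1_out ht1_fix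
    have e2 := aux_second (π (ε ((d : ZMod (d + 1)) - 1))) (π (ε 0)) (π (Fin.last d)) tc t0 b1 b0
      (hinv _) (hinv _) (hinv _) ht1_inv ht0_inv hpath0 ht1_out ht0_fix hb1 hb0
    rw [Set.pair_comm b1] at e2
    rw [e1, e2, hpq] at hρcap
    push_cast at hρcap
    linarith
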